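/- arXiv:1112.6148 — 2 statements merged into one kernel-verified Lean document; each statement's English description precedes it below -/
import Mathlib

section
/- Let w := Σ_{m=1}^M ℓ(Q_m)^{−d} χ_{Q_m}. There exists a constant C₃, depending only on d and C₀, such that for every disc B ⊂ ℝ² one has ( (1/m₂(B)) ∫_{B ∩ X} w dm₂ ) · ( (1/m₂(B)) ∫_{B ∩ X} w^{−1} dm₂ ) ≤ C₃. -/
open MeasureTheory Metric Set
open scoped ENNReal Classical

noncomputable section

/-- The half-open axis-parallel square with center `c` and side length `L`,
i.e. `[c.re - L/2, c.re + L/2) × [c.im - L/2, c.im + L/2)` in `ℝ² = ℂ`. -/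
def square (c : ℂ) (L : ℝ) : Set ℂ :=
  {w : ℂ | w.re ∈ Set.Ico (c.re - L / 2) (c.re + L / 2) ∧
    w.im ∈ Set.Ico (c.im - L / 2) (c.im + L / 2)}

/-- `c` is the center of a dyadic square of side length `2 ^ k`,
i.e. of `2 ^ k • ([0,1)² + z)` for some `z ∈ ℤ²`. -/
def IsDyadicCenter (c : ℂ) (k : ℤ) : Prop :=
  ∃ a b : ℤ, c.re = 2 ^ k * ((a : ℝ) + 1 / 2) ∧ c.im = 2 ^ k * ((b : ℝ) + 1 / 2)

/-- Two dyadic intervals with a common point are nested. -/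
theorem dyadic_interval_nested {k K : ℤ} (hkK : k ≤ K) {a A : ℤ} {x : ℝ}
    (h₁ : (2 : ℝ) ^ k * a ≤ x) (h₂ : x < 2 ^ k * (a + 1))
    (h₃ : (2 : ℝ) ^ K * A ≤ x) (h₄ : x < 2 ^ K * (A + 1)) :
    (2 : ℝ) ^ K * A ≤ 2 ^ k * a ∧ (2 : ℝ) ^ k * (a + 1) ≤ 2 ^ K * (A + 1) := by
  obtain ⟨n, rfl⟩ := Int.le.dest hkK
  have hk : (0 : ℝ) < 2 ^ k := by positivity
  rw [zpow_add₀ two_ne_zero, zpow_natCast, mul_assoc] at *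
  have e₁ : (2 : ℝ) ^ n * A < a + 1 := lt_of_mul_lt_mul_left (h₃.trans_lt h₂) hk.le
  have e₂ : (a : ℝ) < 2 ^ n * (A + 1) := lt_of_mul_lt_mul_left (h₁.trans_lt h₄) hk.le
  have f₁ : (2 : ℤ) ^ n * A < a + 1 := by exact_mod_cast e₁
  have f₂ : a < (2 : ℤ) ^ n * (A + 1) := by exact_mod_cast e₂
  have g₁ : (2 : ℝ) ^ n * A ≤ a := by exact_mod_cast Int.lt_add_one_iff.1 f₁
  have g₂ : (a : ℝ) + 1 ≤ 2 ^ n * (A + 1) := by exact_mod_cast f₂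
  exact ⟨mul_le_mul_of_nonneg_left g₁ hk.le, by
    rw [mul_assoc]; exact mul_le_mul_of_nonneg_left g₂ hk.le⟩

/-- The center of the dyadic square `2 ^ k • ([0,1)² + (a, b))`. -/
def dyadicCenter (k a b : ℤ) : ℂ := ⟨2 ^ k * (a + 1 / 2), 2 ^ k * (b + 1 / 2)⟩

theorem isDyadicCenter_dyadicCenter (k a b : ℤ) : IsDyadicCenter (dyadicCenter k a b) k :=
  ⟨a, b, rfl, rfl⟩

theorem IsDyadicCenter.exists_eq {c : ℂ} {k : ℤ} (h : IsDyadicCenter c k) :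
    ∃ a b : ℤ, c = dyadicCenter k a b := by
  obtain ⟨a, b, h₁, h₂⟩ := h
  exact ⟨a, b, Complex.ext h₁ h₂⟩

theorem mem_square_dyadicCenter {k a b : ℤ} {x : ℂ} :
    x ∈ square (dyadicCenter k a b) (2 ^ k) ↔
      ((2 : ℝ) ^ k * a ≤ x.re ∧ x.re < 2 ^ k * (a + 1)) ∧
        ((2 : ℝ) ^ k * b ≤ x.im ∧ x.im < 2 ^ k * (b + 1)) := by
  have e (t : ℤ) : (2 : ℝ) ^ k * (t + 1 / 2) - 2 ^ k / 2 = 2 ^ k * t := by ring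
  have e' (t : ℤ) : (2 : ℝ) ^ k * (t + 1 / 2) + 2 ^ k / 2 = 2 ^ k * (t + 1) := by ring
  simp only [square, dyadicCenter, mem_ofPred_eq, mem_Ico, e, e']

/-- Two dyadic squares with a common point are nested. -/
theorem square_dyadicCenter_subset {k K a b A B : ℤ} (hkK : k ≤ K) {x : ℂ}
    (hx : x ∈ square (dyadicCenter k a b) (2 ^ k))
    (hX : x ∈ square (dyadicCenter K A B) (2 ^ K)) :
    square (dyadicCenter k a b) (2 ^ k) ⊆ square (dyadicCenter K A B) (2 ^ K) := by
  intro y hy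
  rw [mem_square_dyadicCenter] at *
  obtain ⟨u₁, u₂⟩ := dyadic_interval_nested hkK hx.1.1 hx.1.2 hX.1.1 hX.1.2
  obtain ⟨v₁, v₂⟩ := dyadic_interval_nested hkK hx.2.1 hx.2.2 hX.2.1 hX.2.2
  exact ⟨⟨u₁.trans hy.1.1, hy.1.2.trans_le u₂⟩, ⟨v₁.trans hy.2.1, hy.2.2.trans_le v₂⟩⟩

/-- An interval of length at most `L` meets at most two intervals of the grid of mesh `L`. -/
theorem exists_grid_index {L s x : ℝ} (hL : 0 < L) (h₁ : s ≤ x) (h₂ : x < s + L) :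
    ∃ i : Fin 2, L * ((⌊s / L⌋ + (i : ℕ) : ℤ) : ℝ) ≤ x ∧
      x < L * ((⌊s / L⌋ + (i : ℕ) : ℤ) + 1 : ℝ) := by
  have f₁ : (⌊s / L⌋ : ℝ) * L ≤ s := (le_div_iff₀ hL).1 (Int.floor_le _)
  have f₂ : s < ((⌊s / L⌋ : ℝ) + 1) * L := (div_lt_iff₀ hL).1 (Int.lt_floor_add_one _)
  rcases lt_or_ge x (L * (⌊s / L⌋ + 1)) with h | h
  · exact ⟨0, by push_cast; simp only [Fin.val_zero, Nat.cast_zero]; constructor <;> nlinarith⟩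
  · exact ⟨1, by push_cast; simp only [Fin.val_one, Nat.cast_one]; constructor <;> nlinarith⟩

theorem square_eq_preimage (c : ℂ) (L : ℝ) :
    square c L = Complex.measurableEquivRealProd ⁻¹'
      (Ico (c.re - L / 2) (c.re + L / 2) ×ˢ Ico (c.im - L / 2) (c.im + L / 2)) := rfl

theorem measurableSet_square (c : ℂ) (L : ℝ) : MeasurableSet (square c L) := by
  rw [square_eq_preimage]
  exact Complex.measurableEquivRealProd.measurable (measurableSet_Ico.prod measurableSet_Ico)

theorem volume_square (c : ℂ) {L : ℝ} (hL : 0 ≤ L) :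
    volume (square c L) = ENNReal.ofReal (L ^ 2) := by
  rw [square_eq_preimage, Complex.volume_preserving_equiv_real_prod.measure_preimage_equiv,
    Measure.volume_eq_prod, Measure.prod_prod, Real.volume_Ico, Real.volume_Ico,
    ← ENNReal.ofReal_mul (by linarith)]
  congr 1
  ring

theorem square_subset_square (c : ℂ) {L L' : ℝ} (h : L ≤ L') : square c L ⊆ square c L' := by
  rintro x ⟨⟨h₁, h₂⟩, h₃, h₄⟩
  exact ⟨⟨by linarith, by linarith⟩, by linarith, by linarith⟩

/-- A ball meeting `square c L` and leaving `square c (4 * L)` has radius at least `3 / 4 * L`. -/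
theorem side_le_of_ball_meets {c z x y : ℂ} {L r : ℝ} (hx : x ∈ ball z r) (hy : y ∈ ball z r)
    (hxc : x ∈ square c L) (hyc : y ∉ square c (4 * L)) : L ≤ 2 * r := by
  by_contra! h
  have hxy : dist y x < 2 * r := by
    have := dist_triangle_right y x z
    rw [mem_ball] at hx hy
    linarith
  rw [Complex.dist_eq] at hxy
  have h₁ := abs_lt.1 ((Complex.abs_re_le_norm (y - x)).trans_lt hxy)
  have h₂ := abs_lt.1 ((Complex.abs_im_le_norm (y - x)).trans_lt hxy)
  rw [Complex.sub_re] at h₁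
  rw [Complex.sub_im] at h₂
  obtain ⟨⟨_, _⟩, _, _⟩ := hxc
  exact hyc ⟨⟨by linarith, by linarith⟩, by linarith, by linarith⟩

/-- The packing condition bounds the sum over the squares of side at most `2 ^ K` that meet
a ball of diameter at most `2 ^ K`. -/
theorem sum_meeting_ball_le {ι : Type*} [Fintype ι] {c : ι → ℂ} {k : ι → ℤ} {s C₀ : ℝ}
    (hc : ∀ m, IsDyadicCenter (c m) (k m))
    (hpack : ∀ (c₀ : ℂ) (k₀ : ℤ), IsDyadicCenter c₀ k₀ →
      ∑ m, (if square (c m) (2 ^ (k m)) ⊆ square c₀ (2 ^ k₀)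
        then ((2 : ℝ) ^ (k m)) ^ s else 0) ≤ C₀ * ((2 : ℝ) ^ k₀) ^ s)
    {z : ℂ} {r : ℝ} {K : ℤ} (hK : 2 * r ≤ 2 ^ K)
    (hk : ∀ m, (ball z r ∩ square (c m) (2 ^ (k m))).Nonempty → k m ≤ K) :
    ∑ m, (if (ball z r ∩ square (c m) (2 ^ (k m))).Nonempty
      then ((2 : ℝ) ^ (k m)) ^ s else 0) ≤ 4 * (C₀ * ((2 : ℝ) ^ K) ^ s) := by
  have hL : (0 : ℝ) < 2 ^ K := by positivity
  let D (p : Fin 2 × Fin 2) : ℂ := dyadicCenter K (⌊(z.re - r) / 2 ^ K⌋ + (p.1 : ℕ))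
    (⌊(z.im - r) / 2 ^ K⌋ + (p.2 : ℕ))
  calc
    _ ≤ ∑ m, ∑ p, (if square (c m) (2 ^ (k m)) ⊆ square (D p) (2 ^ K)
        then ((2 : ℝ) ^ (k m)) ^ s else 0) := by
      refine Finset.sum_le_sum fun m _ => ?_
      have hnn (p : Fin 2 × Fin 2) : 0 ≤ (if square (c m) (2 ^ (k m)) ⊆ square (D p) (2 ^ K)
          then ((2 : ℝ) ^ (k m)) ^ s else 0) := by split_ifs <;> positivity
      split_ifs with hm
      · obtain ⟨x, hxB, hxQ⟩ := id hm
        rw [mem_ball, Complex.dist_eq] at hxB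
        have h₁ := abs_lt.1 ((Complex.abs_re_le_norm (x - z)).trans_lt hxB)
        have h₂ := abs_lt.1 ((Complex.abs_im_le_norm (x - z)).trans_lt hxB)
        rw [Complex.sub_re] at h₁
        rw [Complex.sub_im] at h₂
        obtain ⟨i, hi⟩ := exists_grid_index hL (s := z.re - r) (x := x.re)
          (by linarith) (by linarith)
        obtain ⟨j, hj⟩ := exists_grid_index hL (s := z.im - r) (x := x.im)
          (by linarith) (by linarith)
        have hsub : square (c m) (2 ^ (k m)) ⊆ square (D (i, j)) (2 ^ K) := by
          obtain ⟨a, b, hab⟩ := (hc m).exists_eq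
          rw [hab] at hxQ ⊢
          exact square_dyadicCenter_subset (hk m hm) hxQ (mem_square_dyadicCenter.2 ⟨hi, hj⟩)
        refine le_trans ?_ (Finset.single_le_sum (fun p _ => hnn p) (Finset.mem_univ (i, j)))
        rw [if_pos hsub]
      · exact Finset.sum_nonneg fun p _ => hnn p
    _ = ∑ p, ∑ m, (if square (c m) (2 ^ (k m)) ⊆ square (D p) (2 ^ K)
        then ((2 : ℝ) ^ (k m)) ^ s else 0) := Finset.sum_comm
    _ ≤ ∑ _p : Fin 2 × Fin 2, C₀ * ((2 : ℝ) ^ K) ^ s :=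
      Finset.sum_le_sum fun p _ => hpack _ _ (isDyadicCenter_dyadicCenter _ _ _)
    _ = _ := by simp

/-- The integral over a finite disjoint union of a function constant on each piece. -/
theorem setIntegral_inter_iUnion_of_eq_const {ι : Type*} [Fintype ι] {B : Set ℂ} {S : ι → Set ℂ}
    (hB : MeasurableSet B) (hBfin : volume B ≠ ∞) (hS : ∀ m, MeasurableSet (S m))
    (hdisj : Pairwise (Function.onFun Disjoint S)) {f : ℂ → ℝ} {a : ι → ℝ}
    (hf : ∀ m, ∀ x ∈ S m, f x = a m) :
    ∫ x in B ∩ ⋃ m, S m, f x = ∑ m, a m * volume.real (B ∩ S m) := by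
  have hconst (m : ι) : EqOn f (fun _ => a m) (B ∩ S m) := fun x hx => hf m x hx.2
  rw [inter_iUnion, integral_iUnion_fintype (fun m => hB.inter (hS m))
    (fun i j hij => (hdisj hij).mono inter_subset_right inter_subset_right)]
  · refine Finset.sum_congr rfl fun m _ => ?_
    rw [setIntegral_congr_fun (hB.inter (hS m)) (hconst m), setIntegral_const, smul_eq_mul,
      mul_comm]
  · intro m
    rw [integrableOn_congr_fun (hconst m) (hB.inter (hS m))]
    exact integrableOn_const (measure_ne_top_of_subset inter_subset_left hBfin)

/-- the weight `w = Σ_m ℓ(Q_m)^{-d} χ_{Q_m}` satisfies an `A₂`-type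
condition along `X`: for every disc `B`,
`(1/|B|) ∫_{B∩X} w · (1/|B|) ∫_{B∩X} w⁻¹ ≤ C₃`. -/
theorem statement1 (d : ℝ) (hd0 : 0 < d) (hd2 : d < 2) (C₀ : ℝ) (hC₀ : 1 ≤ C₀) :
    ∃ C₃ : ℝ, 0 < C₃ ∧
      ∀ (M : ℕ) (c : Fin M → ℂ) (k : Fin M → ℤ),
        (∀ m, IsDyadicCenter (c m) (k m)) →
        (∀ m m', m ≠ m' →
          square (c m) (4 * 2 ^ (k m)) ∩ square (c m') (4 * 2 ^ (k m')) = ∅) →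
        (∀ (c₀ : ℂ) (k₀ : ℤ), IsDyadicCenter c₀ k₀ →
          ∑ m, (if square (c m) (2 ^ (k m)) ⊆ square c₀ (2 ^ k₀)
                then ((2 : ℝ) ^ (k m)) ^ (2 - d) else 0)
            ≤ C₀ * ((2 : ℝ) ^ k₀) ^ (2 - d)) →
        ∀ (X : Set ℂ), X = ⋃ m, square (c m) (2 ^ (k m)) →
        ∀ (w : ℂ → ℝ),
          (w = fun x => ∑ m, Set.indicator (square (c m) (2 ^ (k m)))
            (fun _ => ((2 : ℝ) ^ (k m)) ^ (-d)) x) →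
        ∀ (z : ℂ) (r : ℝ), 0 < r →
          (((volume (ball z r)).toReal)⁻¹ * ∫ x in ball z r ∩ X, w x ∂volume) *
            (((volume (ball z r)).toReal)⁻¹ * ∫ x in ball z r ∩ X, (w x)⁻¹ ∂volume)
            ≤ C₃ := by
  refine ⟨64 * C₀, by positivity, ?_⟩
  intro M c k hc hdisj hpack X hX w hw z r hr
  subst hX
  have hpos (m : Fin M) : (0 : ℝ) < 2 ^ (k m) := by positivity
  set S : Fin M → Set ℂ := fun m => square (c m) (2 ^ (k m))
  have hmeas (m : Fin M) : MeasurableSet (S m) := measurableSet_square _ _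
  have hsub (m : Fin M) : S m ⊆ square (c m) (4 * 2 ^ (k m)) :=
    square_subset_square _ (by linarith [hpos m])
  have hSdisj : Pairwise (Function.onFun Disjoint S) := fun m m' h =>
    (disjoint_iff_inter_eq_empty.2 (hdisj m m' h)).mono (hsub m) (hsub m')
  have hwS (m : Fin M) : ∀ x ∈ S m, w x = ((2 : ℝ) ^ (k m)) ^ (-d) := by
    intro x hx
    rw [hw]
    beta_reduce
    rw [Finset.sum_eq_single m]
    · exact indicator_of_mem hx _
    · intro m' _ h
      exact indicator_of_notMem (fun hx' => (hSdisj h).le_bot ⟨hx', hx⟩) _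
    · simp
  have hwS' (m : Fin M) : ∀ x ∈ S m, (w x)⁻¹ = ((2 : ℝ) ^ (k m)) ^ d := by
    intro x hx
    rw [hwS m x hx, Real.rpow_neg (hpos m).le, inv_inv]
  have hBfin : volume (ball z r) ≠ ∞ := measure_ball_lt_top.ne
  rw [setIntegral_inter_iUnion_of_eq_const measurableSet_ball hBfin hmeas hSdisj hwS,
    setIntegral_inter_iUnion_of_eq_const measurableSet_ball hBfin hmeas hSdisj hwS']
  have hV : (volume (ball z r)).toReal = Real.pi * r ^ 2 := by
    rw [Complex.volume_ball]
    simp [hr.le, mul_comm]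
  set V := (volume (ball z r)).toReal
  have hV0 : 0 < V := by rw [hV]; positivity
  set v : Fin M → ℝ := fun m => volume.real (ball z r ∩ S m) with hv
  have hv0 (m : Fin M) : 0 ≤ v m := measureReal_nonneg
  have hvV (m : Fin M) : v m ≤ V := measureReal_mono inter_subset_left hBfin
  have hvL (m : Fin M) : v m ≤ ((2 : ℝ) ^ (k m)) ^ 2 := by
    have hvol := volume_square (c m) (hpos m).le
    refine (measureReal_mono inter_subset_right (by rw [hvol]; simp)).trans_eq ?_
    rw [measureReal_def, hvol, ENNReal.toReal_ofReal (by positivity)]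
  have hvsum : ∑ m, v m ≤ V := by
    have hd' : Pairwise (Function.onFun Disjoint fun m => ball z r ∩ S m) := fun i j hij =>
      (hSdisj hij).mono inter_subset_right inter_subset_right
    rw [← measureReal_iUnion_fintype hd' (fun m => measurableSet_ball.inter (hmeas m))
      (fun m => measure_ne_top_of_subset inter_subset_left hBfin)]
    exact measureReal_mono (iUnion_subset fun m => inter_subset_left) hBfin
  have hv_zero (m : Fin M) (h : ¬ (ball z r ∩ S m).Nonempty) : v m = 0 := by
    simp only [hv, not_nonempty_iff_eq_empty.1 h, measureReal_empty]
  change (V⁻¹ * ∑ m, ((2 : ℝ) ^ (k m)) ^ (-d) * v m) *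
    (V⁻¹ * ∑ m, ((2 : ℝ) ^ (k m)) ^ d * v m) ≤ 64 * C₀
  by_cases hone : ∃ m₀, ∀ m, m ≠ m₀ → ¬ (ball z r ∩ S m).Nonempty
  · obtain ⟨m₀, hm₀⟩ := hone
    rw [Finset.sum_eq_single m₀ (fun m _ h => by rw [hv_zero m (hm₀ m h), mul_zero]) (by simp),
      Finset.sum_eq_single m₀ (fun m _ h => by rw [hv_zero m (hm₀ m h), mul_zero]) (by simp)]
    have hcancel : ((2 : ℝ) ^ (k m₀)) ^ (-d) * ((2 : ℝ) ^ (k m₀)) ^ d = 1 := by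
      rw [← Real.rpow_add (hpos m₀), neg_add_cancel, Real.rpow_zero]
    calc
      _ = (((2 : ℝ) ^ (k m₀)) ^ (-d) * ((2 : ℝ) ^ (k m₀)) ^ d) * (v m₀ / V) ^ 2 := by
        rw [div_eq_mul_inv]; ring
      _ = (v m₀ / V) ^ 2 := by rw [hcancel, one_mul]
      _ ≤ 1 := pow_le_one₀ (div_nonneg (hv0 _) hV0.le) ((div_le_one hV0).2 (hvV _))
      _ ≤ 64 * C₀ := by linarith
  · push Not at hone
    obtain ⟨n, hn₁, hn₂⟩ := exists_mem_Ioc_zpow (show 0 < 2 * r by positivity)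
      (one_lt_two : (1 : ℝ) < 2)
    set K := n + 1 with hKdef
    have hL0 : (0 : ℝ) < 2 ^ K := by positivity
    have hL4 : (2 : ℝ) ^ K ≤ 4 * r := by
      rw [hKdef, zpow_add_one₀ two_ne_zero]; linarith
    have hside (m : Fin M) (hm : (ball z r ∩ S m).Nonempty) : (2 : ℝ) ^ (k m) ≤ 2 ^ K := by
      obtain ⟨m', hne, y, hyB, hyS⟩ := hone m
      obtain ⟨x, hxB, hxS⟩ := hm
      refine (side_le_of_ball_meets hxB hyB hxS fun hy => ?_).trans hn₂
      exact (hdisj m m' hne.symm).subset ⟨hy, hsub m' hyS⟩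
    have hW : ∑ m, ((2 : ℝ) ^ (k m)) ^ (-d) * v m ≤ 4 * (C₀ * ((2 : ℝ) ^ K) ^ (2 - d)) := by
      refine le_trans (Finset.sum_le_sum fun m _ => ?_) (sum_meeting_ball_le hc hpack hn₂
        fun m hm => (zpow_le_zpow_iff_right₀ one_lt_two).1 (hside m hm))
      split_ifs with hm
      · calc
          _ ≤ ((2 : ℝ) ^ (k m)) ^ (-d) * ((2 : ℝ) ^ (k m)) ^ 2 :=
            mul_le_mul_of_nonneg_left (hvL m) (by positivity)
          _ = _ := by
            rw [← Real.rpow_natCast, ← Real.rpow_add (hpos m)]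
            congr 1
            push_cast
            ring
      · rw [hv_zero m hm, mul_zero]
    have hW' : ∑ m, ((2 : ℝ) ^ (k m)) ^ d * v m ≤ ((2 : ℝ) ^ K) ^ d * V := by
      refine le_trans (Finset.sum_le_sum fun m _ => ?_)
        ((Finset.mul_sum Finset.univ v (((2 : ℝ) ^ K) ^ d)).symm.trans_le
          (mul_le_mul_of_nonneg_left hvsum (by positivity)))
      by_cases hm : (ball z r ∩ S m).Nonempty
      · exact mul_le_mul_of_nonneg_right
          (Real.rpow_le_rpow (hpos m).le (hside m hm) hd0.le) (hv0 m)
      · rw [hv_zero m hm, mul_zero, mul_zero]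
    have hW'0 : 0 ≤ ∑ m, ((2 : ℝ) ^ (k m)) ^ d * v m :=
      Finset.sum_nonneg fun m _ => mul_nonneg (by positivity) (hv0 m)
    have hprod : ((2 : ℝ) ^ K) ^ (2 - d) * ((2 : ℝ) ^ K) ^ d = ((2 : ℝ) ^ K) ^ 2 := by
      rw [← Real.rpow_add hL0, sub_add_cancel, Real.rpow_two]
    have hLV : ((2 : ℝ) ^ K) ^ 2 ≤ 16 * V := by
      rw [hV]
      nlinarith [Real.pi_gt_three, sq_nonneg r, pow_le_pow_left₀ hL0.le hL4 2]
    calc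
      _ = V⁻¹ * V⁻¹ * ((∑ m, ((2 : ℝ) ^ (k m)) ^ (-d) * v m) *
          ∑ m, ((2 : ℝ) ^ (k m)) ^ d * v m) := by ring
      _ ≤ V⁻¹ * V⁻¹ * ((4 * (C₀ * ((2 : ℝ) ^ K) ^ (2 - d))) * (((2 : ℝ) ^ K) ^ d * V)) := by
        gcongr
      _ = 4 * C₀ * (((2 : ℝ) ^ K) ^ (2 - d) * ((2 : ℝ) ^ K) ^ d) * V⁻¹ := by
        field_simp
      _ = 4 * C₀ * (((2 : ℝ) ^ K) ^ 2 / V) := by rw [hprod]; ring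
      _ ≤ 4 * C₀ * 16 := by
        gcongr
        exact (div_le_iff₀ hV0).2 hLV
      _ = 64 * C₀ := by ring
end
end

section
/- Let (Y, ρ) be a metric space and ν a locally finite Borel measure on Y. Then there is an absolute constant C (independent of Y and ν) such that for every measurable f : Y → ℝ one has ∫_Y (M_{ν,3} f)² dν ≤ C ∫_Y f² dν; in particular the maximal operator M_{ν,3} is bounded on L²(ν) for an arbitrary such measure ν. -/
open MeasureTheory Metric Set
open scoped ENNReal

noncomputable section

/-- The modified maximal operator
`M_{ν,3} f(x) := sup_{R>0} (1/ν(B(x,3R))) ∫_{B(x,R)} |f| dν`,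
with the convention that a term is `0` when `ν(B(x,3R)) = ∞`
(in `ℝ≥0∞` one has `∞⁻¹ = 0` and `0 * ∞ = 0`). -/
def maxOp {Y : Type*} [PseudoMetricSpace Y] [MeasurableSpace Y] (ν : Measure Y)
    (f : Y → ℝ) (x : Y) : ℝ≥0∞ :=
  ⨆ (R : ℝ) (_ : 0 < R),
    (ν (ball x (3 * R)))⁻¹ * ∫⁻ y in ball x R, (‖f y‖₊ : ℝ≥0∞) ∂ν

/-- Covering argument of Vitali type for balls of bounded radius: only the centres have to be
covered, so the enlargement factor `3` suffices. -/
theorem mul_measure_le_of_forall_ball_of_le {Y : Type*} [PseudoMetricSpace Y] [MeasurableSpace Y]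
    [OpensMeasurableSpace Y] (μ ν : Measure Y) (c : ℝ≥0∞) (N : ℝ) (S : Set Y)
    (hS : ∀ x ∈ S, ∃ R : ℝ, 0 < R ∧ R ≤ N ∧ c * ν (ball x (3 * R)) < μ (ball x R)) :
    c * ν S ≤ μ univ := by
  rcases eq_or_ne (μ univ) ∞ with hμ | hμ
  · simp [hμ]
  have : IsFiniteMeasure μ := ⟨hμ.lt_top⟩
  choose! r hr0 hrN hr using hS
  obtain ⟨u, huS, hdisj, hcov⟩ := Vitali.exists_disjoint_subfamily_covering_enlargement
    (fun x => ball x (r x)) S r 2 one_lt_two (fun x hx => (hr0 x hx).le) N hrN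
    (fun x hx => nonempty_ball.2 (hr0 x hx))
  have hpd : Pairwise (Function.onFun Disjoint fun x : u => ball (x : Y) (r x)) :=
    fun x y hxy => hdisj x.2 y.2 (Subtype.coe_injective.ne hxy)
  have hcount : Countable u := by
    have h := Measure.countable_meas_pos_of_disjoint_iUnion (μ := μ)
      (As := fun x : u => ball (x : Y) (r x)) (fun _ => measurableSet_ball) hpd
    have huniv : {x : u | 0 < μ (ball (x : Y) (r x))} = univ :=
      eq_univ_of_forall fun x => pos_of_gt (hr x (huS x.2))
    rw [huniv] at h
    exact countable_univ_iff.1 h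
  have hsub : S ⊆ ⋃ x : u, ball (x : Y) (3 * r x) := by
    intro x hx
    obtain ⟨y, hyu, ⟨z, hzx, hzy⟩, hle⟩ := hcov x hx
    refine mem_iUnion.2 ⟨⟨y, hyu⟩, ?_⟩
    rw [mem_ball] at *
    have := dist_triangle_left x y z
    linarith
  calc c * ν S ≤ c * ∑' x : u, ν (ball (x : Y) (3 * r x)) := by
        gcongr
        exact (measure_mono hsub).trans (measure_iUnion_le _)
    _ = ∑' x : u, c * ν (ball (x : Y) (3 * r x)) := ENNReal.tsum_mul_left.symm
    _ ≤ ∑' x : u, μ (ball (x : Y) (r x)) :=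
        ENNReal.tsum_le_tsum fun x => (hr x (huS x.2)).le
    _ = μ (⋃ x : u, ball (x : Y) (r x)) :=
        (measure_iUnion hpd fun _ => measurableSet_ball).symm
    _ ≤ μ univ := measure_mono (subset_univ _)

theorem mul_measure_le_of_forall_ball {Y : Type*} [PseudoMetricSpace Y] [MeasurableSpace Y]
    [OpensMeasurableSpace Y] (μ ν : Measure Y) (c : ℝ≥0∞) (S : Set Y)
    (hS : ∀ x ∈ S, ∃ R : ℝ, 0 < R ∧ c * ν (ball x (3 * R)) < μ (ball x R)) :
    c * ν S ≤ μ univ := by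
  let T : ℕ → Set Y := fun n =>
    {x | x ∈ S ∧ ∃ R : ℝ, 0 < R ∧ R ≤ n ∧ c * ν (ball x (3 * R)) < μ (ball x R)}
  have hT : Monotone T := by
    rintro m n hmn x ⟨hx, R, h0, hR, h⟩
    exact ⟨hx, R, h0, hR.trans (Nat.cast_le.2 hmn), h⟩
  have hST : S ⊆ ⋃ n, T n := by
    intro x hx
    obtain ⟨R, h0, h⟩ := hS x hx
    obtain ⟨n, hn⟩ := exists_nat_ge R
    exact mem_iUnion.2 ⟨n, hx, R, h0, hn, h⟩
  calc c * ν S ≤ c * ν (⋃ n, T n) := by gcongr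
    _ = ⨆ n, c * ν (T n) := by rw [hT.measure_iUnion, ENNReal.mul_iSup]
    _ ≤ μ univ := iSup_le fun n =>
        mul_measure_le_of_forall_ball_of_le μ ν c n (T n) fun _ hx => hx.2

/-- Weak type estimate for `maxOp`, with only the large values of `f` on the right-hand side. -/
theorem mul_measure_lt_maxOp_le {Y : Type*} [PseudoMetricSpace Y] [MeasurableSpace Y]
    [OpensMeasurableSpace Y] (ν : Measure Y) {f : Y → ℝ} (hf : Measurable f) (c : NNReal) :
    c * ν {x | 2 * (c : ℝ≥0∞) < maxOp ν f x} ≤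
      ν.withDensity (fun y => (‖f y‖₊ : ℝ≥0∞)) {y | c < ‖f y‖₊} := by
  have hA : MeasurableSet {y | c < ‖f y‖₊} := measurableSet_lt measurable_const hf.nnnorm
  set μ := ν.withDensity fun y => (‖f y‖₊ : ℝ≥0∞)
  rw [← Measure.restrict_apply_univ {y | c < ‖f y‖₊}]
  refine mul_measure_le_of_forall_ball _ ν c _ fun x hx => ?_
  simp only [mem_ofPred_eq, maxOp, lt_iSup_iff] at hx
  obtain ⟨R, hR, h⟩ := hx
  refine ⟨R, hR, ?_⟩
  have hsub : ball x R ⊆ ball x (3 * R) := ball_subset_ball (by linarith)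
  have h1 : 2 * (c : ℝ≥0∞) * ν (ball x (3 * R)) < μ (ball x R) := by
    rw [withDensity_apply _ measurableSet_ball]
    rw [mul_comm _ (∫⁻ y in ball x R, _ ∂ν), ← div_eq_mul_inv] at h
    exact ENNReal.mul_lt_of_lt_div h
  have h2 : μ (ball x R \ {y | c < ‖f y‖₊}) ≤ c * ν (ball x (3 * R)) := by
    rw [withDensity_apply _ (measurableSet_ball.diff hA)]
    calc _ ≤ ∫⁻ _ in ball x R \ {y | c < ‖f y‖₊}, (c : ℝ≥0∞) ∂ν :=
          setLIntegral_mono measurable_const fun y hy => by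
            simpa using hy.2
      _ = c * ν (ball x R \ {y | c < ‖f y‖₊}) := setLIntegral_const _ _
      _ ≤ c * ν (ball x (3 * R)) := by
          gcongr
          exact sdiff_subset.trans hsub
  rw [Measure.restrict_apply measurableSet_ball]
  rw [← measure_inter_add_sdiff (ball x R) hA, mul_assoc, two_mul] at h1
  by_contra! hcon
  exact h1.not_ge (add_le_add hcon h2)

theorem lintegral_sq_le_of_mul_measure_lt_le {Y : Type*} [MeasurableSpace Y] (ν : Measure Y)
    (F : Y → ℝ≥0∞) {f : Y → ℝ} (hf : Measurable f)
    (h : ∀ c : NNReal, c * ν {x | 2 * (c : ℝ≥0∞) < F x} ≤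
      ν.withDensity (fun y => (‖f y‖₊ : ℝ≥0∞)) {y | c < ‖f y‖₊}) :
    ∫⁻ x, F x ^ 2 ∂ν ≤ 8 * ∫⁻ x, (‖f x‖₊ : ℝ≥0∞) ^ 2 ∂ν := by
  set μ := ν.withDensity fun y => (‖f y‖₊ : ℝ≥0∞) with hμ
  rw [lintegral_eq_nnreal]
  refine iSup₂_le fun φ hφ => ?_
  rw [← SimpleFunc.lintegral_eq_lintegral]
  let g : Y → ℝ := fun x => √(φ x : ℝ)
  have hg : Measurable g := (measurable_coe_nnreal_real.comp φ.measurable).sqrt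
  have hg_sq : ∀ x, g x ^ 2 = φ x := fun x => Real.sq_sqrt (φ x).2
  have hgF : ∀ x, ENNReal.ofReal (g x) ≤ F x := by
    intro x
    have h1 : ENNReal.ofReal (g x) ^ 2 ≤ F x ^ 2 := by
      rw [← ENNReal.ofReal_pow (Real.sqrt_nonneg _), hg_sq,
        ENNReal.ofReal_coe_nnreal]
      exact hφ x
    exact (ENNReal.pow_le_pow_left_iff two_ne_zero).1 h1
  have key : ∀ t ∈ Ioi (0 : ℝ), ν {x | t < g x} * ENNReal.ofReal (t ^ ((2 : ℝ) - 1)) ≤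
      2 * μ {y | t < 2 * ‖f y‖} := by
    intro t ht
    have ht0 : 0 < t := ht
    have ht2 : ENNReal.ofReal t = 2 * ((t / 2).toNNReal : ℝ≥0∞) := by
      change _ = 2 * ENNReal.ofReal (t / 2)
      rw [← ENNReal.ofReal_ofNat 2, ← ENNReal.ofReal_mul (by norm_num)]
      congr 1
      ring
    have hset : {y | (t / 2).toNNReal < ‖f y‖₊} = {y | t < 2 * ‖f y‖} := by
      ext y
      simp only [mem_ofPred_eq]
      rw [← NNReal.coe_lt_coe, Real.coe_toNNReal _ (by positivity), coe_nnnorm,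
        div_lt_iff₀' two_pos]
    have hsub : {x | t < g x} ⊆ {x | 2 * ((t / 2).toNNReal : ℝ≥0∞) < F x} := by
      intro x hx
      rw [mem_ofPred_eq, ← ht2]
      exact ((ENNReal.ofReal_lt_ofReal_iff (ht0.trans hx)).2 hx).trans_le (hgF x)
    have h1 := h (t / 2).toNNReal
    rw [hset] at h1
    have : (2 : ℝ) - 1 = 1 := by norm_num
    rw [this, Real.rpow_one, ht2, mul_comm, mul_assoc]
    gcongr
    exact (by gcongr : _ ≤ _).trans h1
  calc ∫⁻ x, φ.map (fun r : NNReal => (r : ℝ≥0∞)) x ∂ν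
      = ∫⁻ x, ENNReal.ofReal (g x ^ (2 : ℝ)) ∂ν := by
        refine lintegral_congr fun x => ?_
        rw [Real.rpow_two, hg_sq, ENNReal.ofReal_coe_nnreal]
        rfl
    _ = ENNReal.ofReal 2 *
          ∫⁻ t in Ioi (0 : ℝ), ν {x | t < g x} * ENNReal.ofReal (t ^ ((2 : ℝ) - 1)) :=
        lintegral_rpow_eq_lintegral_meas_lt_mul ν
          (Filter.Eventually.of_forall fun _ => Real.sqrt_nonneg _) hg.aemeasurable two_pos
    _ ≤ ENNReal.ofReal 2 * ∫⁻ t in Ioi (0 : ℝ), 2 * μ {y | t < 2 * ‖f y‖} := by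
        refine mul_le_mul_right ?_ _
        exact setLIntegral_mono' measurableSet_Ioi key
    _ = 4 * ∫⁻ y, ENNReal.ofReal (2 * ‖f y‖) ∂μ := by
        rw [lintegral_const_mul' _ _ (by simp), ← mul_assoc,
          lintegral_eq_lintegral_meas_lt μ
            (Filter.Eventually.of_forall fun _ => by positivity)
            (hf.norm.const_mul 2).aemeasurable, ENNReal.ofReal_ofNat]
        norm_num
    _ = 8 * ∫⁻ x, (‖f x‖₊ : ℝ≥0∞) ^ 2 ∂ν := by
        rw [hμ, lintegral_withDensity_eq_lintegral_mul _ hf.nnnorm.coe_nnreal_ennreal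
          (hf.norm.const_mul 2).ennreal_ofReal, ← lintegral_const_mul' _ _ (by simp),
          ← lintegral_const_mul' _ _ (by simp)]
        refine lintegral_congr fun x => ?_
        simp only [Pi.mul_apply]
        rw [ENNReal.ofReal_mul (by norm_num), ENNReal.ofReal_ofNat, ← coe_nnnorm,
          ENNReal.ofReal_coe_nnreal]
        ring

/-- for any metric space `Y` and any locally finite Borel measure `ν`
on `Y`, the maximal operator `M_{ν,3}` is bounded on `L²(ν)`, with an absolute
constant independent of `Y` and `ν`. -/
theorem statement5 :
    ∃ C : ℝ, 0 < C ∧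
      ∀ (Y : Type*) [MetricSpace Y] [MeasurableSpace Y] [BorelSpace Y]
        (ν : Measure Y) [IsLocallyFiniteMeasure ν] (f : Y → ℝ), Measurable f →
        ∫⁻ x, (maxOp ν f x) ^ 2 ∂ν
          ≤ ENNReal.ofReal C * ∫⁻ x, (‖f x‖₊ : ℝ≥0∞) ^ 2 ∂ν := by
  refine ⟨8, by norm_num, fun Y _ _ _ ν _ f hf => ?_⟩
  rw [ENNReal.ofReal_ofNat]
  exact lintegral_sq_le_of_mul_measure_lt_le ν _ hf (mul_measure_lt_maxOp_le ν hf)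
end
end
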